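/- Let n ≥ 1 and consider any realization of the configuration T_n by segments with all endpoints on the parabola y = x². If, in every copy of every Z_{2^k} occurring in T_n, the three whisker segments a, b, c intersect concavely, then at least one of the 2^n groups of n + 1 numeric segments forms a wide set. -/

import Mathlib

/-! ### Sequences with special blocks, encoded as token lists

A sequence with special blocks is encoded as a list of tokens: `Tok.sym a` is an
occurrence of the symbol `a`, and `Tok.op` / `Tok.cl` are the opening and closing
parentheses delimiting the special blocks. -/

/-- Tokens of a symbol sequence with special blocks. -/
inductive Tok : Type where
  | sym : ℕ → Tok
  | op : Tok
  | cl : Tok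
deriving DecidableEq, Repr

/-- Tokens of an endpoint sequence with special blocks: `L a` / `R a` are the
left/right endpoint letters of the symbol `a`, and `op`/`cl` delimit blocks. -/
inductive ETok : Type where
  | L : ℕ → ETok
  | R : ℕ → ETok
  | op : ETok
  | cl : ETok
deriving DecidableEq, Repr

/-- Fresh relabeling of the symbols of the `i`-th local copy. -/
def loc (i a : ℕ) : ℕ := 2 * Nat.pair i a

/-- Relabeling of the global symbols. -/
def glob (a : ℕ) : ℕ := 2 * a + 1

/-- The underlying sequence of symbols of a token list (parentheses dropped). -/
def symsOf : List Tok → List ℕ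
  | [] => []
  | Tok.sym a :: r => a :: symsOf r
  | _ :: r => symsOf r

/-- Read a special block: the symbols up to (and excluding) the next closing
parenthesis, together with the remainder of the list after that parenthesis. -/
def takeBlock : List Tok → List ℕ × List Tok
  | [] => ([], [])
  | Tok.cl :: r => ([], r)
  | Tok.sym a :: r => ((takeBlock r).1.cons a, (takeBlock r).2)
  | Tok.op :: r => takeBlock r

theorem takeBlock_len : ∀ l : List Tok, (takeBlock l).2.length ≤ l.length := by
  intro l
  induction l with
  | nil => simp [takeBlock]
  | cons t r ih => cases t <;> simp [takeBlock] <;> omega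

/-- Auxiliary function for the shuffle `A • B`: traverse the `i`-th fresh copy of
`A` (relabeling its symbols by `loc i`), inserting the next global symbol of the
list `ins` (relabeled by `glob`) at the end of each special block and duplicating
the previously last symbol of that block immediately after the block.  The third
argument remembers the (relabeled) last symbol seen. -/
def copyIns (i : ℕ) : List Tok → List ℕ → Option ℕ → List Tok
  | [], _, _ => []
  | Tok.sym a :: r, ins, _ => Tok.sym (loc i a) :: copyIns i r ins (some (loc i a))
  | Tok.op :: r, ins, p => Tok.op :: copyIns i r ins p
  | Tok.cl :: r, b :: ins, some q =>
      Tok.sym (glob b) :: Tok.cl :: Tok.sym q :: copyIns i r ins (some q)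
  | Tok.cl :: r, ins, p => Tok.cl :: copyIns i r ins p

/-- The modified copy `Aᵢ'` of `A` used in the shuffle `A • B`: the symbols of the
`i`-th special block `blk` of `B` are inserted into the special blocks of the copy,
and another copy of the last symbol of `blk` is appended at the very end. -/
def copyA (i : ℕ) (A : List Tok) (blk : List ℕ) : List Tok :=
  copyIns i A blk none ++ (blk.getLast?.elim [] fun a => [Tok.sym (glob a)])

/-- Auxiliary function for the shuffle: traverse `B` (relabeling its symbols by
`glob`), replacing its `i`-th special block by the modified `i`-th copy of `A`. -/
def bulletAux (A : List Tok) : ℕ → List Tok → List Tok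
  | _, [] => []
  | i, Tok.op :: r => copyA i A (takeBlock r).1 ++ bulletAux A (i + 1) (takeBlock r).2
  | i, Tok.sym a :: r => Tok.sym (glob a) :: bulletAux A i r
  | i, Tok.cl :: r => Tok.cl :: bulletAux A i r
termination_by _ l => l.length
decreasing_by
  · exact Nat.lt_succ_of_le (takeBlock_len r)
  · exact Nat.lt_succ_self _
  · exact Nat.lt_succ_self _

/-- The shuffle `A • B` of two sequences with special blocks. -/
def bullet (A B : List Tok) : List Tok := bulletAux A 0 B

/-- Split each special block of length 2 into two special blocks of length 1. -/
def split2 : List Tok → List Tok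
  | Tok.op :: Tok.sym a :: Tok.sym b :: Tok.cl :: r =>
      Tok.op :: Tok.sym a :: Tok.cl :: Tok.op :: Tok.sym b :: Tok.cl :: split2 r
  | t :: r => t :: split2 r
  | [] => []

/-- The Hart–Sharir sequence `S₁(m) = (1 2 ⋯ m) (m−1) ⋯ 2 1 2 ⋯ m`,
with a single special block `(1 2 ⋯ m)`. -/
def S1 (m : ℕ) : List Tok :=
  Tok.op :: ((List.range' 1 m).map Tok.sym) ++ Tok.cl ::
    (((List.range' 1 (m - 1)).reverse.map Tok.sym) ++ ((List.range' 2 (m - 1)).map Tok.sym))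

/-- The number of special blocks of a token sequence. -/
def numBlocks (S : List Tok) : ℕ := S.count Tok.op

/-- The Hart–Sharir sequences `S_k(m)`, defined by double recursion:
`S₁(m)` is the `N`-shaped sequence above; for `k ≥ 2`, `S_k(1)` is `S_{k−1}(2)` with
each special block of length 2 split into two special blocks of length 1; and for
`k, m ≥ 2`, `S_k(m) = S_k(m−1) • S_{k−1}(N)` where `N` is the number of special
blocks of `S_k(m−1)`.  (The value for `k = 0` or `m = 0` is junk.) -/
def HS : ℕ → ℕ → List Tok
  | 0, _ => []
  | 1, m => S1 m
  | _ + 2, 0 => []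
  | k + 2, 1 => split2 (HS (k + 1) 2)
  | k + 2, m + 2 => bullet (HS (k + 2) (m + 1)) (HS (k + 1) (numBlocks (HS (k + 2) (m + 1))))
termination_by k m => (k, m)



/-- The list of special blocks of a token sequence (each block as its list of symbols). -/
def blocksOf : List Tok → List (List ℕ)
  | [] => []
  | Tok.op :: r => (takeBlock r).1 :: blocksOf (takeBlock r).2
  | _ :: r => blocksOf r
termination_by l => l.length
decreasing_by
  · exact Nat.lt_succ_of_le (takeBlock_len r)
  · exact Nat.lt_succ_self _

/-- The rank of a symbol: the position (counting from 1) that its first occurrence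
occupies within its special block (`0` if the symbol lies in no special block). -/
def rankOf (S : List Tok) (a : ℕ) : ℕ :=
  match (blocksOf S).find? (fun b => decide (a ∈ b)) with
  | some b => b.idxOf a + 1
  | none => 0

/-- Two symbols have their first occurrences in the same special block. -/
def SameBlock (S : List Tok) (a b : ℕ) : Prop :=
  ∃ blk ∈ blocksOf S, a ∈ blk ∧ b ∈ blk

/-- The symbol `a` is left-clamped in the sequence `s`: `s` contains the
subsequence `b a b a`, where `b` is the symbol immediately preceding the first
occurrence of `a` in `s`. -/
def LeftClamped (s : List ℕ) (a : ℕ) : Prop :=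
  ∃ (u v : List ℕ) (b : ℕ), s = u ++ b :: a :: v ∧ a ∉ u ∧ b ≠ a ∧
    [b, a, b, a].Sublist s

/-- The symbol `a` is right-clamped in the sequence `s`: `s` contains the
subsequence `a b a b`, where `b` is the symbol immediately following the last
occurrence of `a` in `s`. -/
def RightClamped (s : List ℕ) (a : ℕ) : Prop :=
  ∃ (u v : List ℕ) (b : ℕ), s = u ++ a :: b :: v ∧ a ∉ v ∧ b ≠ a ∧
    [a, b, a, b].Sublist s

/-- Auxiliary function for the endpoint sequence: the first argument collects the
symbols already seen.  The first occurrence of each symbol becomes an `L` letter,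
its last occurrence becomes an `R` letter, all other occurrences are deleted, and
parentheses are kept. -/
def EAux : List ℕ → List Tok → List ETok
  | _, [] => []
  | seen, Tok.op :: r => ETok.op :: EAux seen r
  | seen, Tok.cl :: r => ETok.cl :: EAux seen r
  | seen, Tok.sym a :: r =>
      if a ∈ seen then
        if a ∈ symsOf r then EAux seen r else ETok.R a :: EAux seen r
      else ETok.L a :: EAux (a :: seen) r

/-- The endpoint sequence `E(S)` of a sequence with special blocks. -/
def Efun (S : List Tok) : List ETok := EAux [] S

/-- Read a special block of an endpoint sequence: the labels of the `L` letters up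
to the next closing parenthesis, and the remainder of the list after it. -/
def takeBlockE : List ETok → List ℕ × List ETok
  | [] => ([], [])
  | ETok.cl :: r => ([], r)
  | ETok.L a :: r => ((takeBlockE r).1.cons a, (takeBlockE r).2)
  | _ :: r => takeBlockE r

theorem takeBlockE_len : ∀ l : List ETok, (takeBlockE l).2.length ≤ l.length := by
  intro l
  induction l with
  | nil => simp [takeBlockE]
  | cons t r ih => cases t <;> simp [takeBlockE] <;> omega

/-- Auxiliary function for the endpoint shuffle `A ∘ B`: traverse the `i`-th fresh
copy of `A` (relabeling by `loc i`), inserting the next left-endpoint letter of the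
list `ins` (relabeled by `glob`) at the end of each special block. -/
def ecopyIns (i : ℕ) : List ETok → List ℕ → List ETok
  | [], _ => []
  | ETok.L a :: r, ins => ETok.L (loc i a) :: ecopyIns i r ins
  | ETok.R a :: r, ins => ETok.R (loc i a) :: ecopyIns i r ins
  | ETok.op :: r, ins => ETok.op :: ecopyIns i r ins
  | ETok.cl :: r, b :: ins => ETok.L (glob b) :: ETok.cl :: ecopyIns i r ins
  | ETok.cl :: r, [] => ETok.cl :: ecopyIns i r []

/-- Auxiliary function for the endpoint shuffle: traverse `B` (relabeling by
`glob`), replacing its `i`-th special block by the `i`-th modified copy of `A`. -/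
def eshufAux (A : List ETok) : ℕ → List ETok → List ETok
  | _, [] => []
  | i, ETok.op :: r => ecopyIns i A (takeBlockE r).1 ++ eshufAux A (i + 1) (takeBlockE r).2
  | i, ETok.L a :: r => ETok.L (glob a) :: eshufAux A i r
  | i, ETok.R a :: r => ETok.R (glob a) :: eshufAux A i r
  | i, ETok.cl :: r => ETok.cl :: eshufAux A i r
termination_by _ l => l.length
decreasing_by
  · exact Nat.lt_succ_of_le (takeBlockE_len r)
  · exact Nat.lt_succ_self _
  · exact Nat.lt_succ_self _
  · exact Nat.lt_succ_self _

/-- The endpoint shuffle `A ∘ B` of two endpoint sequences with special blocks. -/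
def eshuffle (A B : List ETok) : List ETok := eshufAux A 0 B

/-- The token list is a well-formed sequence with special blocks: a concatenation
of symbols and of parenthesized blocks consisting only of symbols. -/
inductive Blocked : List Tok → Prop
  | nil : Blocked []
  | sym (a : ℕ) {l : List Tok} : Blocked l → Blocked (Tok.sym a :: l)
  | blk (b : List ℕ) {l : List Tok} :
      Blocked l → Blocked (Tok.op :: b.map Tok.sym ++ Tok.cl :: l)

/-- The special blocks of `S` contain only first occurrences of symbols, and every
symbol of `S` makes its first occurrence inside a special block. -/
def FirstOccBlocks (S : List Tok) : Prop :=
  (∀ (u b v : List Tok), S = u ++ Tok.op :: b ++ Tok.cl :: v →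
      ∀ a : ℕ, Tok.sym a ∈ b → a ∉ symsOf u ∧ (symsOf b).count a = 1) ∧
  (∀ a ∈ symsOf S, ∃ (u b v : List Tok),
      S = u ++ Tok.op :: b ++ Tok.cl :: v ∧ Tok.sym a ∈ b ∧ a ∉ symsOf u)

/-! ### Geometry of the parabola -/

/-- The point of the parabola `y = x²` with x-coordinate `t`. -/
noncomputable def Ppt (t : ℝ) : ℝ × ℝ := (t, t ^ 2)

/-- The closed straight-line segment between the points of the parabola with
x-coordinates `a` and `b`. -/
noncomputable def Seg (a b : ℝ) : Set (ℝ × ℝ) := segment ℝ (Ppt a) (Ppt b)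

/-- Given left and right endpoint x-coordinates `xL`, `xR` for the segments named
by labels, the segments named by the list `ls = [s₁, …, sₘ]` intersect concavely:
for each three consecutive members, the intersection point `s_{k+2} ∩ s_{k+1}` lies
strictly to the left of the intersection point `s_{k+1} ∩ s_k`; that is, the
intersection points `sₘ ∩ sₘ₋₁, …, s₂ ∩ s₁` have strictly increasing x-coordinates. -/
def ConcaveChain (xL xR : ℕ → ℝ) (ls : List ℕ) : Prop :=
  ∀ k, k + 3 ≤ ls.length → ∀ z w : ℝ × ℝ,
    z ∈ Seg (xL (ls.getD (k + 2) 0)) (xR (ls.getD (k + 2) 0)) ∩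
        Seg (xL (ls.getD (k + 1) 0)) (xR (ls.getD (k + 1) 0)) →
    w ∈ Seg (xL (ls.getD (k + 1) 0)) (xR (ls.getD (k + 1) 0)) ∩
        Seg (xL (ls.getD k 0)) (xR (ls.getD k 0)) →
    z.1 < w.1

/-- The list of endpoint x-coordinates read along an endpoint sequence. -/
noncomputable def coordList (xL xR : ℕ → ℝ) (S : List ETok) : List ℝ :=
  S.filterMap fun t =>
    match t with
    | ETok.L a => some (xL a)
    | ETok.R a => some (xR a)
    | _ => none

/-- The family of segments with endpoints on the parabola given by the endpoint
x-coordinates `xL`, `xR` realizes the endpoint sequence `S`: reading the endpoints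
by increasing x-coordinate yields exactly `S` (in particular all endpoint
x-coordinates are pairwise distinct). -/
noncomputable def Realizes (xL xR : ℕ → ℝ) (S : List ETok) : Prop :=
  (coordList xL xR S).Chain' (· < ·)

/-! ### The configurations `F_m`, `Z_m`, `T_n`, `Y` and `X` -/

/-- The endpoint sequence `F_m = (L₁ ⋯ L_m) R₁ ⋯ R_m`, with one special block. -/
def Fseq (m : ℕ) : List ETok :=
  ETok.op :: ((List.range' 1 m).map ETok.L) ++ ETok.cl :: ((List.range' 1 m).map ETok.R)

/-- The endpoint sequence
`Z_m = L_a L_b (L₁ ⋯ L_m) R₁ ⋯ R_m L_c R_a (L_{m+1} ⋯ L_{2m}) R_{m+1} ⋯ R_{2m} R_b R_c`,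
with two special blocks.  The whisker labels are `a = 2m+1`, `b = 2m+2`, `c = 2m+3`,
and the numeric segments are labeled `1, …, 2m`. -/
def Zseq (m : ℕ) : List ETok :=
  ETok.L (2 * m + 1) :: ETok.L (2 * m + 2) ::
    ETok.op :: ((List.range' 1 m).map ETok.L) ++ ETok.cl :: ((List.range' 1 m).map ETok.R) ++
    ETok.L (2 * m + 3) :: ETok.R (2 * m + 1) ::
    ETok.op :: ((List.range' (m + 1) m).map ETok.L) ++
    ETok.cl :: ((List.range' (m + 1) m).map ETok.R) ++
    [ETok.R (2 * m + 2), ETok.R (2 * m + 3)]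

/-- The partial configurations `A_j = (⋯(Z₁ ∘ Z₂) ∘ ⋯ ) ∘ Z_{2^j}`. -/
def Aseq : ℕ → List ETok
  | 0 => Zseq 1
  | j + 1 => eshuffle (Aseq j) (Zseq (2 ^ (j + 1)))

/-- The configuration `T_n = (⋯(((Z₁ ∘ Z₂) ∘ Z₄) ∘ Z₈) ∘ ⋯ ∘ Z_{2^{n−1}}) ∘ F_{2^n}`. -/
def Tseq (n : ℕ) : List ETok := eshuffle (Aseq (n - 1)) (Fseq (2 ^ n))

/-- The label triples `(a, b, c)` of the whiskers of `A_j`, tracked through the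
relabelings performed by the endpoint shuffles. -/
def AWhiskers : ℕ → Set (ℕ × ℕ × ℕ)
  | 0 => {(3, 4, 5)}
  | j + 1 =>
      {(glob (2 * 2 ^ (j + 1) + 1), glob (2 * 2 ^ (j + 1) + 2), glob (2 * 2 ^ (j + 1) + 3))} ∪
      {w | ∃ i < 2, ∃ t ∈ AWhiskers j, w = (loc i t.1, loc i t.2.1, loc i t.2.2)}

/-- The label triples `(a, b, c)` of the whiskers of `T_n`. -/
def TWhiskers (n : ℕ) : Set (ℕ × ℕ × ℕ) :=
  {w | ∃ t ∈ AWhiskers (n - 1), w = (loc 0 t.1, loc 0 t.2.1, loc 0 t.2.2)}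

/-- The endpoint sequence `Y = L_d L_e ( ) ( ) L_f R_d ( ) ( ) R_e R_f ( )`,
with five empty special blocks; the labels are `d = 1`, `e = 2`, `f = 3`. -/
def Yseq : List ETok :=
  [ETok.L 1, ETok.L 2, ETok.op, ETok.cl, ETok.op, ETok.cl, ETok.L 3, ETok.R 1,
   ETok.op, ETok.cl, ETok.op, ETok.cl, ETok.R 2, ETok.R 3, ETok.op, ETok.cl]

/-- The configuration `X = Y ∘ T₄` of 173 segments. -/
def Xseq : List ETok := eshuffle Yseq (Tseq 4)

/-! ### The geometric dichotomy -/

/-- Membership in a chord of the parabola, in terms of the equation of its supporting line. -/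
theorem mem_Seg_of_line {p q x : ℝ} (hpx : p ≤ x) (hxq : x ≤ q) (hpq : p < q) :
    (x, (p + q) * x - p * q) ∈ Seg p q := by
  have h : 0 < q - p := sub_pos.2 hpq
  refine ⟨(q - x) / (q - p), (x - p) / (q - p), by apply div_nonneg <;> linarith,
    by apply div_nonneg <;> linarith, by field_simp; ring, ?_⟩
  ext
  · simp only [Ppt, Prod.smul_mk, Prod.mk_add_mk, smul_eq_mul]
    field_simp
    ring
  · simp only [Ppt, Prod.smul_mk, Prod.mk_add_mk, smul_eq_mul]
    field_simp
    ring

/-- Two interleaving chords `(p, r)` and `(q, s)` meet above the abscissa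
`(q s - p r) / (q + s - p - r)`. -/
theorem exists_mem_Seg_inter {p q r s : ℝ} (hpq : p < q) (hqr : q < r) (hrs : r < s) :
    ∃ y, ((q * s - p * r) / (q + s - p - r), y) ∈ Seg q s ∩ Seg p r := by
  have hd : 0 < q + s - p - r := by linarith
  set x := (q * s - p * r) / (q + s - p - r) with hx
  have hxd : x * (q + s - p - r) = q * s - p * r := by rw [hx]; field_simp
  have hqx : q ≤ x := by
    rw [hx, le_div_iff₀ hd]
    nlinarith [mul_pos (sub_pos.2 hpq) (sub_pos.2 hqr)]
  have hxr : x ≤ r := by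
    rw [hx, div_le_iff₀ hd]
    nlinarith [mul_pos (sub_pos.2 hqr) (sub_pos.2 hrs)]
  refine ⟨(q + s) * x - q * s, mem_Seg_of_line hqx (by linarith) (by linarith), ?_⟩
  have : (q + s) * x - q * s = (p + r) * x - p * r := by linarith
  rw [this]
  exact mem_Seg_of_line (by linarith) hxr (by linarith)

/-- If `a, b, c` intersect concavely, then the right endpoint of `c` is far away relative to one
of the two gaps enclosing the special blocks of the copy of `Z_m` with whisker `a, b, c`. -/
theorem ConcaveChain.far_right {xL xR : ℕ → ℝ} {a b c : ℕ}
    (h : ConcaveChain xL xR [a, b, c]) (hab : xL a < xL b) (hbc : xL b < xL c)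
    (hca : xL c < xR a) (hab' : xR a < xR b) (hbc' : xR b < xR c) :
    2 * xL c - xL b ≤ xR c ∨ 2 * xR b - xR a ≤ xR c := by
  by_contra! hcon
  obtain ⟨h₁, h₂⟩ := hcon
  obtain ⟨z, hz⟩ := exists_mem_Seg_inter hbc (hca.trans hab') hbc'
  obtain ⟨w, hw⟩ := exists_mem_Seg_inter hab (hbc.trans hca) hab'
  have key := h 0 (by simp) _ _ (by simpa using hz) (by simpa using hw)
  simp only at key
  rw [div_lt_div_iff₀ (by linarith) (by linarith)] at key
  set t := xL b - xL a with ht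
  set C := xL c - xL b with hC
  set A' := xR a - xL b with hA'
  set B' := xR b - xL b with hB'
  set C' := xR c - xL b with hC'
  have e₁ : xL a = xL b - t := by simp [ht]
  have e₂ : xL c = xL b + C := by simp [hC]
  have e₃ : xR a = xL b + A' := by simp [hA']
  have e₄ : xR b = xL b + B' := by simp [hB']
  have e₅ : xR c = xL b + C' := by simp [hC']
  have t0 : 0 < t := by linarith
  have C0 : 0 < C := by linarith
  have k₁ : C' < 2 * C := by linarith
  have k₂ : C' + A' < 2 * B' := by linarith
  have k₃ : C < A' := by linarith
  have k₄ : A' < B' := by linarith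
  have k₅ : B' < C' := by linarith
  rw [e₁, e₂, e₃, e₄, e₅] at key
  have key' : C * C' * (B' + t - A') < t * A' * (C + C' - B') := by nlinarith [key]
  have l₁ : C * C' * t < t * A' * (C + C' - B') := by
    nlinarith [mul_pos (mul_pos C0 (by linarith : 0 < C')) (sub_pos.2 k₄)]
  have l₂ : C * C' < A' * (C + C' - B') := by nlinarith
  nlinarith [mul_pos (by linarith : 0 < A') (sub_pos.2 k₂),
    mul_pos (by linarith : 0 < C' - A') (by linarith : 0 < 2 * C - A')]

theorem concaveChain_comp {xL xR : ℕ → ℝ} {φ : ℕ → ℕ} {a b c : ℕ}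
    (h : ConcaveChain xL xR [φ a, φ b, φ c]) :
    ConcaveChain (xL ∘ φ) (xR ∘ φ) [a, b, c] := by
  intro k hk
  obtain rfl : k = 0 := by simpa using hk
  simpa using h 0 (by simp)

/-! ### Wide lists of segments -/

/-- The segments named by the list `b` form a wide set. -/
def IsWide (xL xR : ℕ → ℝ) (b : List ℕ) : Prop :=
  ∀ k, 1 ≤ k → k + 1 ≤ b.length →
    xR (b.getD k 0) - xL (b.getD 0 0) > 2 * (xR (b.getD (k - 1) 0) - xL (b.getD 0 0))

theorem isWide_pair {xL xR : ℕ → ℝ} {s t : ℕ} (h : 2 * xR s - xL s < xR t) :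
    IsWide xL xR [s, t] := by
  intro k h₁ h₂
  obtain rfl : k = 1 := by simp at h₂; omega
  simp
  linarith

/-- A wide list may be relabeled and extended by a segment reaching far enough to the right. -/
theorem IsWide.map_append {xL xR : ℕ → ℝ} {φ : ℕ → ℕ} {b : List ℕ} {s e : ℕ}
    (h : IsWide (xL ∘ φ) (xR ∘ φ) (b ++ [s]))
    (hlast : 2 * xR (φ s) - xL (φ ((b ++ [s]).getD 0 0)) < xR e) :
    IsWide xL xR ((b ++ [s]).map φ ++ [e]) := by
  have hget : ∀ k, k < (b ++ [s]).length →
      ((b ++ [s]).map φ ++ [e]).getD k 0 = φ ((b ++ [s]).getD k 0) := by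
    intro k hk
    rw [List.getD_append _ _ _ _ (by simpa using hk), List.getD_eq_getElem _ _ (by simpa using hk),
      List.getD_eq_getElem _ _ hk, List.getElem_map]
  intro k h₁ h₂
  rw [hget 0 (by simp)]
  rw [hget (k - 1) (by simp at h₂ ⊢; omega)]
  rcases lt_or_ge k (b ++ [s]).length with hk | hk
  · rw [hget k hk]
    exact h k h₁ hk
  · obtain rfl : k = b.length + 1 := by simp at hk h₂; omega
    have h₃ : ((b ++ [s]).map φ ++ [e]).getD (b.length + 1) 0 = e := by simp [List.getD]
    have h₄ : (b ++ [s]).getD (b.length + 1 - 1) 0 = s := by simp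
    rw [h₃, h₄]
    linarith

/-! ### Coordinates along endpoint sequences -/

@[simp] theorem coordList_nil (xL xR : ℕ → ℝ) : coordList xL xR [] = [] := rfl

@[simp] theorem coordList_L (xL xR : ℕ → ℝ) (a : ℕ) (S : List ETok) :
    coordList xL xR (ETok.L a :: S) = xL a :: coordList xL xR S := rfl

@[simp] theorem coordList_R (xL xR : ℕ → ℝ) (a : ℕ) (S : List ETok) :
    coordList xL xR (ETok.R a :: S) = xR a :: coordList xL xR S := rfl

@[simp] theorem coordList_op (xL xR : ℕ → ℝ) (S : List ETok) :
    coordList xL xR (ETok.op :: S) = coordList xL xR S := rfl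

@[simp] theorem coordList_cl (xL xR : ℕ → ℝ) (S : List ETok) :
    coordList xL xR (ETok.cl :: S) = coordList xL xR S := rfl

@[simp] theorem coordList_append (xL xR : ℕ → ℝ) (S S' : List ETok) :
    coordList xL xR (S ++ S') = coordList xL xR S ++ coordList xL xR S' :=
  List.filterMap_append

theorem mem_coordList_of_L_mem {xL xR : ℕ → ℝ} {S : List ETok} {a : ℕ} (h : ETok.L a ∈ S) :
    xL a ∈ coordList xL xR S :=
  List.mem_filterMap.2 ⟨_, h, rfl⟩

theorem mem_coordList_of_R_mem {xL xR : ℕ → ℝ} {S : List ETok} {a : ℕ} (h : ETok.R a ∈ S) :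
    xR a ∈ coordList xL xR S :=
  List.mem_filterMap.2 ⟨_, h, rfl⟩

/-- The relabeled original letters form a subsequence of a copy with insertions. -/
theorem coordList_sublist_ecopyIns (xL xR : ℕ → ℝ) (i : ℕ) (S : List ETok) (ins : List ℕ) :
    (coordList (xL ∘ loc i) (xR ∘ loc i) S).Sublist (coordList xL xR (ecopyIns i S ins)) := by
  induction S generalizing ins with
  | nil => simp
  | cons t S ih =>
    cases t with
    | L a => simpa [ecopyIns] using ih ins
    | R a => simpa [ecopyIns] using ih ins
    | op => simpa [ecopyIns] using ih ins
    | cl =>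
      cases ins with
      | nil => simpa [ecopyIns] using ih []
      | cons d ins => simpa [ecopyIns] using (ih ins).cons _

/-! ### Structure of the endpoint shuffle -/

theorem ecopyIns_append (i : ℕ) (S S' : List ETok) (ins : List ℕ) :
    ecopyIns i (S ++ S') ins =
      ecopyIns i S ins ++ ecopyIns i S' (ins.drop (S.count ETok.cl)) := by
  induction S generalizing ins with
  | nil => simp [ecopyIns]
  | cons t S ih =>
    cases t with
    | L a => simp [ecopyIns, ih]
    | R a => simp [ecopyIns, ih]
    | op => simp [ecopyIns, ih]
    | cl => cases ins <;> simp [ecopyIns, ih]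

theorem ecopyIns_map_L (i : ℕ) (b : List ℕ) (S : List ETok) (ins : List ℕ) :
    ecopyIns i (b.map ETok.L ++ S) ins = (b.map (loc i)).map ETok.L ++ ecopyIns i S ins := by
  induction b with
  | nil => simp
  | cons a b ih => simpa [ecopyIns] using ih

theorem count_cl_ecopyIns (i : ℕ) (S : List ETok) (ins : List ℕ) :
    (ecopyIns i S ins).count ETok.cl = S.count ETok.cl := by
  induction S generalizing ins with
  | nil => simp [ecopyIns]
  | cons t S ih =>
    cases t with
    | L a => simp [ecopyIns, ih]
    | R a => simp [ecopyIns, ih]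
    | op => simp [ecopyIns, ih]
    | cl => cases ins <;> simp [ecopyIns, ih]

/-- A special block of `S` gains one letter when letters are inserted into a copy of `S`. -/
theorem exists_ecopyIns_block (i : ℕ) (u v : List ETok) (b ins : List ℕ)
    (h : u.count ETok.cl < ins.length) :
    ∃ e ∈ ins, ∃ u' v', ecopyIns i (u ++ (ETok.op :: b.map ETok.L) ++ (ETok.cl :: v)) ins =
      u' ++ (ETok.op :: (b.map (loc i) ++ [glob e]).map ETok.L) ++ (ETok.cl :: v') := by
  refine ⟨ins[u.count ETok.cl], List.getElem_mem h, ecopyIns i u ins,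
    ecopyIns i v (ins.drop (u.count ETok.cl + 1)), ?_⟩
  rw [List.append_assoc, ecopyIns_append, List.cons_append]
  simp only [ecopyIns]
  rw [ecopyIns_map_L, List.drop_eq_getElem_cons h]
  simp [ecopyIns]

theorem takeBlockE_block (b : List ℕ) (S : List ETok) :
    takeBlockE (b.map ETok.L ++ ETok.cl :: S) = (b, S) := by
  induction b with
  | nil => simp [takeBlockE]
  | cons a b ih => simp [takeBlockE, ih]

theorem eshufAux_block (A : List ETok) (i : ℕ) (b : List ℕ) (S : List ETok) :
    eshufAux A i (ETok.op :: (b.map ETok.L ++ ETok.cl :: S)) =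
      ecopyIns i A b ++ eshufAux A (i + 1) S := by
  rw [eshufAux, takeBlockE_block]

theorem eshufAux_map_R (A : List ETok) (i : ℕ) (b : List ℕ) (S : List ETok) :
    eshufAux A i (b.map ETok.R ++ S) =
      (b.map glob).map ETok.R ++ eshufAux A i S := by
  induction b with
  | nil => simp
  | cons a b ih => simp [eshufAux, ih]

theorem eshuffle_Fseq (A : List ETok) (m : ℕ) :
    eshuffle A (Fseq m) =
      ecopyIns 0 A (List.range' 1 m) ++ ((List.range' 1 m).map glob).map ETok.R := by
  have h := eshufAux_map_R A 1 (List.range' 1 m) []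
  rw [List.append_nil] at h
  rw [eshuffle, Fseq, List.cons_append, eshufAux_block, h]
  simp [eshufAux]

theorem eshuffle_Zseq (A : List ETok) (m : ℕ) :
    eshuffle A (Zseq m) =
      [ETok.L (glob (2 * m + 1)), ETok.L (glob (2 * m + 2))] ++
      (ecopyIns 0 A (List.range' 1 m) ++
      (((List.range' 1 m).map glob).map ETok.R ++
      ([ETok.L (glob (2 * m + 3)), ETok.R (glob (2 * m + 1))] ++
      (ecopyIns 1 A (List.range' (m + 1) m) ++
      (((List.range' (m + 1) m).map glob).map ETok.R ++
      [ETok.R (glob (2 * m + 2)), ETok.R (glob (2 * m + 3))]))))) := by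
  simp only [eshuffle, Zseq, List.cons_append, List.append_assoc, eshufAux, eshufAux_block,
    eshufAux_map_R, List.nil_append]

theorem count_cl_map_R (b : List ℕ) : (b.map ETok.R).count ETok.cl = 0 := by
  simp [List.count_eq_zero]

theorem count_cl_Aseq (j : ℕ) : (Aseq j).count ETok.cl = 2 ^ (j + 1) := by
  induction j with
  | zero => decide
  | succ j ih =>
    rw [Aseq, eshuffle_Zseq]
    simp only [List.count_append, count_cl_ecopyIns, count_cl_map_R, ih]
    simp
    ring

/-! ### Wide blocks -/

/-- Some special block of `S` is wide and ends with the letter of some `s ∈ tops`. -/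
def HasWideBlock (xL xR : ℕ → ℝ) (S : List ETok) (tops : List ℕ) : Prop :=
  ∃ (u : List ETok) (b : List ℕ) (s : ℕ) (v : List ETok), s ∈ tops ∧
    S = u ++ (ETok.op :: (b ++ [glob s]).map ETok.L) ++ (ETok.cl :: v) ∧
    IsWide xL xR (b ++ [glob s])

theorem HasWideBlock.append {xL xR : ℕ → ℝ} {S : List ETok} {tops : List ℕ}
    (h : HasWideBlock xL xR S tops) (P Q : List ETok) :
    HasWideBlock xL xR (P ++ (S ++ Q)) tops := by
  obtain ⟨u, b, s, v, hs, rfl, hw⟩ := h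
  exact ⟨P ++ u, b, s, v ++ Q, hs, by simp, hw⟩

theorem HasWideBlock.ecopyIns_append {xL xR : ℕ → ℝ} {i : ℕ} {P S Q : List ETok} {ins : List ℕ}
    (h : HasWideBlock xL xR (ecopyIns i S (ins.drop (P.count ETok.cl)))
      (ins.drop (P.count ETok.cl))) :
    HasWideBlock xL xR (ecopyIns i (P ++ (S ++ Q)) ins) ins := by
  rw [_root_.ecopyIns_append, _root_.ecopyIns_append i S]
  obtain ⟨u, b, s, v, hs, hS, hw⟩ := h.append (_root_.ecopyIns i P ins) _
  exact ⟨u, b, s, v, List.mem_of_mem_drop hs, hS, hw⟩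

/-- Inserting sufficiently long segments into a copy of `S` preserves wide blocks: it suffices that
the letters of `S` lie right of `lo`, that the segments in `tops` end left of `hi`, and that all
inserted segments end right of `2 * hi - lo`. -/
theorem HasWideBlock.ecopyIns {xL xR : ℕ → ℝ} {i : ℕ} {S : List ETok} {tops ins : List ℕ}
    {lo hi : ℝ} (h : HasWideBlock (xL ∘ loc i) (xR ∘ loc i) S tops)
    (hlen : S.count ETok.cl ≤ ins.length)
    (hlo : ∀ t ∈ coordList (xL ∘ loc i) (xR ∘ loc i) S, lo ≤ t)
    (hhi : ∀ s ∈ tops, xR (loc i (glob s)) ≤ hi)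
    (hins : ∀ e ∈ ins, 2 * hi - lo < xR (glob e)) :
    HasWideBlock xL xR (ecopyIns i S ins) ins := by
  obtain ⟨u, b, s, v, hs, rfl, hw⟩ := h
  have hcount : u.count ETok.cl < ins.length := by
    simp only [List.count_append, List.count_cons_self] at hlen
    omega
  obtain ⟨e, he, u', v', heq⟩ := exists_ecopyIns_block i u v (b ++ [glob s]) ins hcount
  refine ⟨u', (b ++ [glob s]).map (loc i), e, v', he, heq, hw.map_append ?_⟩
  have hmem : (b ++ [glob s]).getD 0 0 ∈ b ++ [glob s] := by
    rw [List.getD_eq_getElem _ _ (by simp)]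
    exact List.getElem_mem _
  have h₁ : lo ≤ xL (loc i ((b ++ [glob s]).getD 0 0)) := by
    refine hlo _ (mem_coordList_of_L_mem (xL := xL ∘ loc i) ?_)
    exact List.mem_append_left _
      (List.mem_append_right _ (List.mem_cons_of_mem _ (List.mem_map_of_mem hmem)))
  linarith [hins e he, hhi s hs]

/-- In any realization of a copy of `A_j` with inserted segments that end to the right of
the copy, if all whiskers of the copy are concave, then some special block is wide. -/
theorem hasWideBlock_ecopyIns_Aseq (j i : ℕ) (xL xR : ℕ → ℝ) (ins : List ℕ)
    (hlen : ins.length = 2 ^ (j + 1))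
    (hsorted : (coordList xL xR (ecopyIns i (Aseq j) ins)).Pairwise (· < ·))
    (hins : ∀ e ∈ ins, ∀ t ∈ coordList xL xR (ecopyIns i (Aseq j) ins), t < xR (glob e))
    (hwhisk : ∀ t ∈ AWhiskers j, ConcaveChain (xL ∘ loc i) (xR ∘ loc i) [t.1, t.2.1, t.2.2]) :
    HasWideBlock xL xR (ecopyIns i (Aseq j) ins) ins := by
  induction j generalizing i xL xR ins with
  | zero =>
    obtain ⟨p, q, rfl⟩ := List.length_eq_two.1 hlen
    have hcopy : ecopyIns i (Aseq 0) [p, q] =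
        [ETok.L (loc i 3), ETok.L (loc i 4), ETok.op, ETok.L (loc i 1), ETok.L (glob p), ETok.cl,
          ETok.R (loc i 1), ETok.L (loc i 5), ETok.R (loc i 3), ETok.op, ETok.L (loc i 2),
          ETok.L (glob q), ETok.cl, ETok.R (loc i 2), ETok.R (loc i 4), ETok.R (loc i 5)] := rfl
    rw [hcopy] at hsorted hins ⊢
    have hc := hwhisk (3, 4, 5) rfl
    simp only [coordList_L, coordList_R, coordList_op, coordList_cl, coordList_nil,
      List.pairwise_cons, List.mem_cons, List.not_mem_nil, or_false, forall_eq_or_imp,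
      forall_eq] at hsorted hins
    rcases hc.far_right (by simp; tauto) (by simp; tauto) (by simp; tauto) (by simp; tauto)
      (by simp; tauto) with h | h
    · simp only [Function.comp] at h
      exact ⟨[ETok.L (loc i 3), ETok.L (loc i 4)], [loc i 1], p, _, by simp, rfl,
        isWide_pair (by linarith)⟩
    · simp only [Function.comp] at h
      exact ⟨[ETok.L (loc i 3), ETok.L (loc i 4), ETok.op, ETok.L (loc i 1), ETok.L (glob p),
        ETok.cl, ETok.R (loc i 1), ETok.L (loc i 5), ETok.R (loc i 3)], [loc i 2], q, _, by simp,
        rfl, isWide_pair (by linarith)⟩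
  | succ j ih =>
    have hsub := coordList_sublist_ecopyIns xL xR i (Aseq (j + 1)) ins
    have hsorted' := hsorted.sublist hsub
    have hins' : ∀ e ∈ ins, ∀ t ∈ coordList (xL ∘ loc i) (xR ∘ loc i) (Aseq (j + 1)),
        t < xR (glob e) := fun e he t ht => hins e he t (hsub.subset ht)
    have htop : ConcaveChain (xL ∘ loc i) (xR ∘ loc i) [glob (2 * 2 ^ (j + 1) + 1),
        glob (2 * 2 ^ (j + 1) + 2), glob (2 * 2 ^ (j + 1) + 3)] :=
      hwhisk (_, _, _) (Or.inl (Set.mem_singleton _))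
    have hinner : ∀ k < 2, ∀ t ∈ AWhiskers j, ConcaveChain ((xL ∘ loc i) ∘ loc k)
        ((xR ∘ loc i) ∘ loc k) [t.1, t.2.1, t.2.2] := fun k hk t ht =>
      concaveChain_comp
        (hwhisk (loc k t.1, loc k t.2.1, loc k t.2.2) (Or.inr ⟨k, hk, t, ht, rfl⟩))
    clear hsub hwhisk hsorted hins
    rw [Aseq, eshuffle_Zseq] at hsorted' hins' ⊢
    set m := 2 ^ (j + 1) with hm
    set E₀ := ecopyIns 0 (Aseq j) (List.range' 1 m) with hE₀
    set E₁ := ecopyIns 1 (Aseq j) (List.range' (m + 1) m) with hE₁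
    have hcount₀ : E₀.count ETok.cl = m := by rw [hE₀, count_cl_ecopyIns, count_cl_Aseq]
    have hcount₁ : E₁.count ETok.cl = m := by rw [hE₁, count_cl_ecopyIns, count_cl_Aseq]
    have hlen' : ins.length = m + m := by rw [hlen, pow_succ]; omega
    have hR : ∀ (l : List ℕ), ∀ s ∈ l, (xR ∘ loc i) (glob s) ∈
        coordList (xL ∘ loc i) (xR ∘ loc i) ((l.map glob).map ETok.R) := fun l s hs =>
      mem_coordList_of_R_mem (xR := xR ∘ loc i) (by simpa using ⟨s, hs, rfl⟩)
    simp only [coordList_append, List.pairwise_append, coordList_L, coordList_R, coordList_nil,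
      List.pairwise_cons, List.mem_append, List.mem_cons, List.not_mem_nil, or_false,
      forall_eq_or_imp, forall_eq] at hsorted'
    obtain ⟨⟨hab, -⟩, ⟨hE₀s, ⟨-, ⟨⟨hca, -⟩, ⟨hE₁s, ⟨-, ⟨hbc', -⟩, hR₁bc⟩, hE₁lt⟩, hcalt⟩, hR₀lt⟩,
      hE₀lt⟩, -, hblt⟩ := hsorted'
    have hc_lt : ∀ e ∈ ins, (xR ∘ loc i) (glob (2 * m + 3)) < xR (glob e) := fun e he =>
      hins' e he _ (mem_coordList_of_R_mem (xR := xR ∘ loc i) (by simp))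
    rcases htop.far_right hab (hblt _ (by simp)) hca (hcalt.2 _ (by simp)) hbc' with h | h
    · refine HasWideBlock.ecopyIns_append (P := [_, _]) ?_
      refine HasWideBlock.ecopyIns (tops := List.range' 1 m) (ih 0 _ _ _ (by simp) hE₀s ?_
        (hinner 0 (by simp))) (by simp; omega) (fun t ht => (hblt t (Or.inl ht)).le)
        (fun s hs => (hR₀lt _ (hR _ s hs) _ (Or.inl (Or.inl rfl))).le)
        fun e he => h.trans_lt (hc_lt e (List.mem_of_mem_drop he))
      exact fun e he t ht => hE₀lt t ht _ (Or.inl (hR _ e he))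
    · set P := [ETok.L (glob (2 * m + 1)), ETok.L (glob (2 * m + 2))] ++ (E₀ ++
        (((List.range' 1 m).map glob).map ETok.R ++
          [ETok.L (glob (2 * m + 3)), ETok.R (glob (2 * m + 1))])) with hP
      have hPcount : P.count ETok.cl = m := by
        simp only [hP, List.count_append, count_cl_map_R, hcount₀]
        simp
      have hassoc (S : List ETok) : [ETok.L (glob (2 * m + 1)), ETok.L (glob (2 * m + 2))] ++ (E₀ ++
        (((List.range' 1 m).map glob).map ETok.R ++
          ([ETok.L (glob (2 * m + 3)), ETok.R (glob (2 * m + 1))] ++ S))) = P ++ S := by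
        simp only [hP, List.append_assoc]
      rw [hassoc]
      refine HasWideBlock.ecopyIns_append ?_
      rw [hPcount]
      refine HasWideBlock.ecopyIns (tops := List.range' (m + 1) m) (ih 1 _ _ _ (by simp) hE₁s ?_
        (hinner 1 (by simp))) (by simp; omega) (fun t ht => (hcalt.2 t (Or.inl ht)).le)
        (fun s hs => (hR₁bc _ (hR _ s hs)).1.le)
        fun e he => h.trans_lt (hc_lt e (List.mem_of_mem_drop he))
      exact fun e he t ht => hE₁lt t ht _ (Or.inl (hR _ e he))

/-- Lemma `lemma_one_wide`: for `n ≥ 1`, in any realization of the configuration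
`T_n` by segments with all endpoints on the parabola `y = x²`, if in every copy of
every `Z_{2^k}` occurring in `T_n` the three whisker segments `a, b, c` intersect
concavely, then at least one of the `2^n` groups of `n + 1` numeric segments (the
groups being the special blocks of `T_n`) forms a wide set. -/
theorem lemma_one_wide (n : ℕ) (hn : 1 ≤ n) (xL xR : ℕ → ℝ)
    (hreal : Realizes xL xR (Tseq n))
    (hwhisk : ∀ w ∈ TWhiskers n, ConcaveChain xL xR [w.1, w.2.1, w.2.2]) :
    ∃ (u : List ETok) (b : List ℕ) (v : List ETok),
      Tseq n = u ++ (ETok.op :: b.map ETok.L) ++ (ETok.cl :: v) ∧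
      ∀ k, 1 ≤ k → k + 1 ≤ b.length →
        xR (b.getD k 0) - xL (b.getD 0 0) > 2 * (xR (b.getD (k - 1) 0) - xL (b.getD 0 0)) := by
  have hsorted : (coordList xL xR (Tseq n)).Pairwise (· < ·) := List.isChain_iff_pairwise.1 hreal
  have hT : Tseq n = ecopyIns 0 (Aseq (n - 1)) (List.range' 1 (2 ^ n)) ++
      ((List.range' 1 (2 ^ n)).map glob).map ETok.R := eshuffle_Fseq _ _
  rw [hT] at hsorted ⊢
  rw [coordList_append, List.pairwise_append] at hsorted
  have hwide : HasWideBlock xL xR (ecopyIns 0 (Aseq (n - 1)) (List.range' 1 (2 ^ n)))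
      (List.range' 1 (2 ^ n)) := by
    refine hasWideBlock_ecopyIns_Aseq _ _ _ _ _ ?_ hsorted.1 ?_ ?_
    · rw [List.length_range', Nat.sub_add_cancel hn]
    · intro e he t ht
      exact hsorted.2.2 t ht _ (mem_coordList_of_R_mem (by simpa using ⟨e, by simpa using he, rfl⟩))
    · exact fun t ht => concaveChain_comp
        (hwhisk (loc 0 t.1, loc 0 t.2.1, loc 0 t.2.2) ⟨t, ht, rfl⟩)
  obtain ⟨u, b, s, v, -, hS, hw⟩ := hwide.append []
    (((List.range' 1 (2 ^ n)).map glob).map ETok.R)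
  exact ⟨u, b ++ [glob s], v, hS, hw⟩
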